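/- arXiv:math/0701682 — 2 statements merged into one kernel-verified Lean document; each statement's English description precedes it below -/
import Mathlib

section
/- If A and B are multi-Toeplitz operators on F²(Hₙ) (i.e., Rᵢ* A Rⱼ = δᵢⱼ A and Rᵢ* B Rⱼ = δᵢⱼ B for all i, j ∈ {1,…,n}) which have the same Fourier coefficients, i.e., ⟨A e_{g₀}, e_α⟩ = ⟨B e_{g₀}, e_α⟩ for every α ∈ 𝔽ₙ⁺ and ⟨A e_α, e_{g₀}⟩ = ⟨B e_α, e_{g₀}⟩ for every α with |α| ≥ 1, then A = B. -/
open scoped ENNReal ComplexOrder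
open Filter ContinuousLinearMap

noncomputable section

abbrev Word (n : ℕ) := FreeMonoid (Fin n)

/-- The word determined by a tuple of letters. -/
def word {n k : ℕ} (f : Fin k → Fin n) : Word n :=
  FreeMonoid.ofList (List.ofFn f)

/-- The length of a word. -/
def wordLen {n : ℕ} (α : Word n) : ℕ := (FreeMonoid.toList α).length

/-- The product `X_α = X_{i₁} ⋯ X_{i_k}` for `α = g_{i₁} ⋯ g_{i_k}`. -/
def wordProd {n : ℕ} {K : Type} [NormedAddCommGroup K] [InnerProductSpace ℂ K]
    (X : Fin n → K →L[ℂ] K) (α : Word n) : K →L[ℂ] K :=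
  ((FreeMonoid.toList α).map X).prod

/-- `Σ_{|α| = k} a_α X_α`. -/
def truncSum {n : ℕ} {K : Type} [NormedAddCommGroup K] [InnerProductSpace ℂ K]
    (a : Word n → ℂ) (X : Fin n → K →L[ℂ] K) (k : ℕ) : K →L[ℂ] K :=
  ∑ f : Fin k → Fin n, a (word f) • wordProd X (word f)

/-- `Σ_{|α| = k} b_α X_α*`. -/
def truncSumAdj {n : ℕ} {K : Type} [NormedAddCommGroup K] [InnerProductSpace ℂ K]
    [CompleteSpace K] (b : Word n → ℂ) (X : Fin n → K →L[ℂ] K) (k : ℕ) : K →L[ℂ] K :=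
  ∑ f : Fin k → Fin n, b (word f) • adjoint (wordProd X (word f))

/-- The free holomorphic function `f(X) = Σ_k Σ_{|α| = k} a_α X_α`. -/
def holOp {n : ℕ} {K : Type} [NormedAddCommGroup K] [InnerProductSpace ℂ K]
    (a : Word n → ℂ) (X : Fin n → K →L[ℂ] K) : K →L[ℂ] K :=
  ∑' k : ℕ, truncSum a X k

/-- The free pluriharmonic function
`u(X) = Σ_{k ≥ 1} Σ_{|α| = k} b_α X_α* + a_{g₀} I + Σ_{k ≥ 1} Σ_{|α| = k} a_α X_α`. -/
def phOp {n : ℕ} {K : Type} [NormedAddCommGroup K] [InnerProductSpace ℂ K]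
    [CompleteSpace K] (a b : Word n → ℂ) (X : Fin n → K →L[ℂ] K) : K →L[ℂ] K :=
  (∑' k : ℕ, truncSumAdj b X (k + 1)) + a 1 • (1 : K →L[ℂ] K)
    + ∑' k : ℕ, truncSum a X (k + 1)

/-- Membership in the open noncommutative ball of radius `γ`. -/
def inBall {n : ℕ} {K : Type} [NormedAddCommGroup K] [InnerProductSpace ℂ K]
    [CompleteSpace K] (γ : ℝ) (X : Fin n → K →L[ℂ] K) : Prop :=
  ‖∑ i, X i * adjoint (X i)‖ < γ ^ 2

/-- Membership in the closed noncommutative ball of radius `γ`. -/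
def inClosedBall {n : ℕ} {K : Type} [NormedAddCommGroup K] [InnerProductSpace ℂ K]
    [CompleteSpace K] (γ : ℝ) (X : Fin n → K →L[ℂ] K) : Prop :=
  ‖∑ i, X i * adjoint (X i)‖ ≤ γ ^ 2

/-- The radius-`γ` condition `limsup_k (Σ_{|α|=k} |a_α|²)^{1/(2k)} ≤ 1/γ`. -/
def radCond {n : ℕ} (γ : ℝ) (a : Word n → ℂ) : Prop :=
  Filter.limsup
    (fun k : ℕ =>
      (∑ f : Fin k → Fin n, (‖a (word f)‖₊ : ℝ≥0∞) ^ 2) ^ ((1 : ℝ) / (2 * (k : ℝ))))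
    Filter.atTop ≤ ENNReal.ofReal (1 / γ)

/-- The coefficients of the radial function: `α ↦ r^{|α|} a_α`. -/
def scaleCoef {n : ℕ} (r : ℝ) (a : Word n → ℂ) : Word n → ℂ :=
  fun α => ((r : ℂ) ^ wordLen α) * a α

/-- Positivity of the free pluriharmonic function with coefficients `(a, b)` on the
noncommutative ball of radius `γ` of every complex Hilbert space. -/
def posPH {n : ℕ} (γ : ℝ) (a b : Word n → ℂ) : Prop :=
  ∀ (K : Type) [NormedAddCommGroup K] [InnerProductSpace ℂ K] [CompleteSpace K],
    ∀ X : Fin n → K →L[ℂ] K, inBall γ X → (phOp a b X).IsPositive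


/-- The matrix entry of a multi-Toeplitz operator at two words ending in the letters `i` and `j`
is the entry at the shortened words if `i = j`, and vanishes otherwise. -/
lemma inner_apply_mul_of_of_multiToeplitz {n : ℕ} {F : Type*} [NormedAddCommGroup F]
    [InnerProductSpace ℂ F] [CompleteSpace F] {e : Word n → F} {R : Fin n → F →L[ℂ] F}
    (hR : ∀ (i : Fin n) (α : Word n), R i (e α) = e (α * FreeMonoid.of i)) {A : F →L[ℂ] F}
    (hA : ∀ i j : Fin n, adjoint (R i) ∘L A ∘L R j = if i = j then A else 0)
    (i j : Fin n) (α β : Word n) :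
    inner ℂ (e (β * FreeMonoid.of i)) (A (e (α * FreeMonoid.of j))) =
      if i = j then inner ℂ (e β) (A (e α)) else 0 := by
  have h : adjoint (R i) (A (R j (e α))) = (if i = j then A else 0) (e α) := by
    rw [← hA i j]
    rfl
  rw [← hR, ← hR, ← adjoint_inner_right, h]
  split_ifs <;> simp

/-- Every word is empty or ends in a letter. -/
lemma Word.eq_one_or_eq_mul_of {n : ℕ} (α : Word n) :
    α = 1 ∨ ∃ (β : Word n) (i : Fin n), α = β * FreeMonoid.of i :=
  List.eq_nil_or_concat' α

/-- Multi-Toeplitz operators with the same Fourier coefficients have the same matrix entries. -/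
lemma inner_apply_eq_of_multiToeplitz {n : ℕ} {F : Type*} [NormedAddCommGroup F]
    [InnerProductSpace ℂ F] [CompleteSpace F] {e : Word n → F} {R : Fin n → F →L[ℂ] F}
    (hR : ∀ (i : Fin n) (α : Word n), R i (e α) = e (α * FreeMonoid.of i)) {A B : F →L[ℂ] F}
    (hA : ∀ i j : Fin n, adjoint (R i) ∘L A ∘L R j = if i = j then A else 0)
    (hB : ∀ i j : Fin n, adjoint (R i) ∘L B ∘L R j = if i = j then B else 0)
    (h1 : ∀ α : Word n, inner ℂ (e α) (A (e 1)) = inner ℂ (e α) (B (e 1)))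
    (h2 : ∀ α : Word n, 1 ≤ wordLen α → inner ℂ (e 1) (A (e α)) = inner ℂ (e 1) (B (e α)))
    (α β : Word n) : inner ℂ (e β) (A (e α)) = inner ℂ (e β) (B (e α)) := by
  induction hk : wordLen α generalizing α β with
  | zero =>
    obtain rfl : α = 1 := List.eq_nil_of_length_eq_zero hk
    exact h1 β
  | succ k ih =>
    obtain rfl | ⟨α, j, rfl⟩ := α.eq_one_or_eq_mul_of
    · exact h1 β
    obtain rfl | ⟨β, i, rfl⟩ := β.eq_one_or_eq_mul_of
    · exact h2 _ (by omega)
    · have hα : wordLen α = k := by simpa [wordLen] using hk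
      rw [inner_apply_mul_of_of_multiToeplitz hR hA, inner_apply_mul_of_of_multiToeplitz hR hB,
        ih α β hα]

/-- Two multi-Toeplitz operators on the full Fock space having the same
Fourier coefficients are equal. -/
theorem stmt_0 (n : ℕ) (hn : 1 ≤ n)
    (F : Type) [NormedAddCommGroup F] [InnerProductSpace ℂ F] [CompleteSpace F]
    (e : HilbertBasis (Word n) ℂ F)
    (R : Fin n → F →L[ℂ] F)
    (hR : ∀ (i : Fin n) (α : Word n), R i (e α) = e (α * FreeMonoid.of i))
    (A B : F →L[ℂ] F)
    (hA : ∀ i j : Fin n, adjoint (R i) ∘L A ∘L R j = if i = j then A else 0)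
    (hB : ∀ i j : Fin n, adjoint (R i) ∘L B ∘L R j = if i = j then B else 0)
    (h1 : ∀ α : Word n, (inner ℂ (e α) (A (e 1)) : ℂ) = inner ℂ (e α) (B (e 1)))
    (h2 : ∀ α : Word n, 1 ≤ wordLen α →
      (inner ℂ (e 1) (A (e α)) : ℂ) = inner ℂ (e 1) (B (e α))) :
    A = B := by
  refine ContinuousLinearMap.ext_on
    (Submodule.dense_iff_topologicalClosure_eq_top.mpr e.dense_span) ?_
  rintro _ ⟨α, rfl⟩
  refine e.repr.injective (lp.ext (funext fun β => ?_))
  rw [e.repr_apply_apply, e.repr_apply_apply]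
  exact inner_apply_eq_of_multiToeplitz hR hA hB h1 h2 α β

end
end

section
/- Let A ∈ B(F²(Hₙ)) be a multi-Toeplitz operator with Fourier coefficients (a_α)_{α ∈ 𝔽ₙ⁺} and (b_α)_{|α| ≥ 1}. Then: (a) the families (a_α) and (b_α) are square-summable, so that for each r ∈ [0,1) the series φ_r := Σ_{k=1}^∞ Σ_{|α|=k} b_α r^k S_α* + a_{g₀} I + Σ_{k=1}^∞ Σ_{|α|=k} a_α r^k S_α converges in operator norm; (b) A h = lim_{r→1⁻} φ_r h for every h ∈ F²(Hₙ); (c) the function r ↦ ‖φ_r‖ is nondecreasing on [0,1) and ‖A‖ = sup_{0 ≤ r < 1} ‖φ_r‖ = lim_{r→1⁻} ‖φ_r‖. -/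
open scoped ENNReal ComplexOrder
open Filter ContinuousLinearMap

noncomputable section

/-- The kernel `r ^ |m - k|` is the Gram matrix of finitely supported real vectors. -/
theorem exists_gram_pow_dist {r : ℝ} (hr0 : 0 ≤ r) (hr1 : r ≤ 1) (N : ℕ) :
    ∃ v : ℕ → ℕ → ℝ, ∀ m ≤ N, ∀ k ≤ N,
      ∑ j ∈ Finset.range (N + 1), v j m * v j k = r ^ ((m - k) + (k - m)) := by
  let c : ℕ → ℝ := fun j => if j = 0 then 1 else √(1 - r ^ 2)
  have hc : ∀ m : ℕ, ∑ j ∈ Finset.range (m + 1), r ^ (2 * (m - j)) * c j ^ 2 = 1 := by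
    intro m
    induction m with
    | zero => simp [c]
    | succ m ih =>
      rw [Finset.sum_range_succ]
      have h1 : ∑ j ∈ Finset.range (m + 1), r ^ (2 * (m + 1 - j)) * c j ^ 2
          = r ^ 2 * ∑ j ∈ Finset.range (m + 1), r ^ (2 * (m - j)) * c j ^ 2 := by
        rw [Finset.mul_sum]
        refine Finset.sum_congr rfl fun j hj => ?_
        rw [Finset.mem_range] at hj
        rw [show 2 * (m + 1 - j) = 2 + 2 * (m - j) by lia, pow_add]
        ring
      have h2 : c (m + 1) ^ 2 = 1 - r ^ 2 := by
        simp only [c, Nat.add_eq_zero_iff, one_ne_zero, and_false, if_false]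
        exact Real.sq_sqrt (by nlinarith)
      rw [h1, ih, h2]
      simp
  let v : ℕ → ℕ → ℝ := fun j m => if j ≤ m then r ^ (m - j) * c j else 0
  have key : ∀ m k : ℕ, m ≤ k → k ≤ N →
      ∑ j ∈ Finset.range (N + 1), v j m * v j k = r ^ (k - m) := by
    intro m k hmk hk
    rw [← Finset.sum_subset (s₁ := Finset.range (m + 1)), ← mul_one (r ^ (k - m)), ← hc m,
      Finset.mul_sum]
    · refine Finset.sum_congr rfl fun j hj => ?_
      rw [Finset.mem_range] at hj
      simp only [v, if_pos (show j ≤ m by lia), if_pos (show j ≤ k by lia)]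
      rw [show k - j = (k - m) + (m - j) by lia, pow_add, two_mul, pow_add]
      ring
    · intro j hj
      simp only [Finset.mem_range] at *
      lia
    · intro j _ hj
      simp only [Finset.mem_range] at hj
      simp [v, show ¬ j ≤ m by lia]
  refine ⟨v, fun m hm k hk => ?_⟩
  rcases le_total m k with h | h
  · rw [key m k h hk, Nat.sub_eq_zero_of_le h, zero_add]
  · simp_rw [mul_comm (v _ m)]
    rw [key k m h hm, Nat.sub_eq_zero_of_le h, add_zero]

section Schur

variable {ι F : Type*} [NormedAddCommGroup F] [InnerProductSpace ℂ F]

theorem Orthonormal.norm_sum_smul_sq {e : ι → F} (he : Orthonormal ℂ e) (s : Finset ι)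
    (x : ι → ℂ) : ‖∑ α ∈ s, x α • e α‖ ^ 2 = ∑ α ∈ s, ‖x α‖ ^ 2 := by
  have h := he.inner_sum x x s
  rw [inner_self_eq_norm_sq_to_K] at h
  simp only [RCLike.conj_mul] at h
  exact_mod_cast h

theorem norm_inner_sum_le_of_schur {e : ι → F} (he : Orthonormal ℂ e) (ℓ : ι → ℕ) {r : ℝ}
    (hr0 : 0 ≤ r) (hr1 : r ≤ 1) (B C : F →L[ℂ] F)
    (h : ∀ α β, inner ℂ (e α) (C (e β))
      = (r : ℂ) ^ ((ℓ α - ℓ β) + (ℓ β - ℓ α)) * inner ℂ (e α) (B (e β)))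
    (s : Finset ι) (x y : ι → ℂ) :
    ‖inner ℂ (∑ α ∈ s, y α • e α) (C (∑ α ∈ s, x α • e α))‖
      ≤ ‖B‖ * ‖∑ α ∈ s, x α • e α‖ * ‖∑ α ∈ s, y α • e α‖ := by
  obtain ⟨v, hv⟩ := exists_gram_pow_dist hr0 hr1 (s.sup ℓ)
  set J := Finset.range (s.sup ℓ + 1)
  have hle : ∀ α ∈ s, ℓ α ≤ s.sup ℓ := fun α hα => Finset.le_sup hα
  let X : (ι → ℂ) → ℕ → F := fun x j => ∑ α ∈ s, ((v j (ℓ α) : ℂ) * x α) • e α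
  have hX : ∀ x : ι → ℂ, ∑ j ∈ J, ‖X x j‖ ^ 2 = ‖∑ α ∈ s, x α • e α‖ ^ 2 := by
    intro x
    simp only [X, he.norm_sum_smul_sq]
    rw [Finset.sum_comm]
    refine Finset.sum_congr rfl fun α hα => ?_
    have := hv _ (hle α hα) _ (hle α hα)
    simp only [norm_mul, mul_pow, Complex.norm_real, Real.norm_eq_abs, sq_abs]
    rw [← Finset.sum_mul]
    simp only [sq (v _ _)]
    rw [this]
    simp
  have hsum : inner ℂ (∑ α ∈ s, y α • e α) (C (∑ α ∈ s, x α • e α))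
      = ∑ j ∈ J, inner ℂ (X y j) (B (X x j)) := by
    simp only [X, map_sum, map_smul, sum_inner, inner_sum, inner_smul_left, inner_smul_right,
      Finset.mul_sum]
    conv_rhs => rw [Finset.sum_comm]
    refine Finset.sum_congr rfl fun β hβ => ?_
    conv_rhs => rw [Finset.sum_comm]
    refine Finset.sum_congr rfl fun α hα => ?_
    have := congrArg (fun t : ℝ => (t : ℂ)) (hv _ (hle α hα) _ (hle β hβ))
    push_cast at this
    rw [h, ← this, Finset.sum_mul, Finset.mul_sum, Finset.mul_sum]
    refine Finset.sum_congr rfl fun j _ => ?_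
    simp only [map_mul, Complex.conj_ofReal]
    ring
  calc _ ≤ ∑ j ∈ J, ‖B‖ * (‖X x j‖ * ‖X y j‖) := by
        rw [hsum]
        refine (norm_sum_le _ _).trans (Finset.sum_le_sum fun j _ => ?_)
        calc _ ≤ ‖X y j‖ * ‖B (X x j)‖ := norm_inner_le_norm _ _
          _ ≤ ‖X y j‖ * (‖B‖ * ‖X x j‖) := by gcongr; exact B.le_opNorm _
          _ = _ := by ring
    _ ≤ ‖B‖ * (√(∑ j ∈ J, ‖X x j‖ ^ 2) * √(∑ j ∈ J, ‖X y j‖ ^ 2)) := by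
        rw [← Finset.mul_sum]
        gcongr
        exact Real.sum_mul_le_sqrt_mul_sqrt _ _ _
    _ = _ := by
        rw [hX, hX, Real.sqrt_sq (norm_nonneg _), Real.sqrt_sq (norm_nonneg _), mul_assoc]

/-- Schur multiplication by `r ^ |ℓ α - ℓ β|` does not increase the operator norm. -/
theorem HilbertBasis.opNorm_le_of_schur (e : HilbertBasis ι ℂ F) (ℓ : ι → ℕ) {r : ℝ}
    (hr0 : 0 ≤ r) (hr1 : r ≤ 1) (B C : F →L[ℂ] F)
    (h : ∀ α β, inner ℂ (e α) (C (e β))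
      = (r : ℂ) ^ ((ℓ α - ℓ β) + (ℓ β - ℓ α)) * inner ℂ (e α) (B (e β))) :
    ‖C‖ ≤ ‖B‖ := by
  have key : ∀ x y : F, ‖inner ℂ y (C x)‖ ≤ ‖B‖ * ‖x‖ * ‖y‖ := by
    intro x y
    have hx := e.hasSum_repr x
    have hy := e.hasSum_repr y
    exact le_of_tendsto_of_tendsto' (hy.inner ((C.continuous.tendsto x).comp hx)).norm
      ((hx.norm.const_mul ‖B‖).mul hy.norm)
      fun s => norm_inner_sum_le_of_schur e.orthonormal ℓ hr0 hr1 B C h s _ _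
  refine opNorm_le_of_re_inner_le (𝕜 := ℂ) (norm_nonneg _) fun x y hx hy => ?_
  rw [inner_re_symm]
  simpa [hx, hy] using (RCLike.re_le_norm _).trans (key x y)

theorem HilbertBasis.clm_ext (e : HilbertBasis ι ℂ F) {B C : F →L[ℂ] F}
    (h : ∀ α β, inner ℂ (e α) (B (e β)) = inner ℂ (e α) (C (e β))) : B = C := by
  refine ContinuousLinearMap.ext_on (s := Set.range e) ?_ ?_
  · exact (Submodule.dense_iff_topologicalClosure_eq_top).2 e.dense_span
  · rintro _ ⟨β, rfl⟩
    refine e.repr.injective (Subtype.ext (funext fun α => ?_))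
    simpa only [e.repr_apply_apply] using h α β

theorem HilbertBasis.hasSum_norm_inner_sq (e : HilbertBasis ι ℂ F) (x : F) :
    HasSum (fun α => ‖inner ℂ (e α) x‖ ^ 2) (‖x‖ ^ 2) := by
  have h := lp.hasSum_norm (p := 2) (by norm_num) (e.repr x)
  simpa [e.repr_apply_apply] using h

theorem HilbertBasis.tendsto_apply_of_eventually_norm_le (e : HilbertBasis ι ℂ F) {κ : Type*}
    {l : Filter κ} {T : κ → F →L[ℂ] F} {A : F →L[ℂ] F} {M : ℝ} (hT : ∀ᶠ i in l, ‖T i‖ ≤ M)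
    (he : ∀ β, Tendsto (fun i => T i (e β)) l (nhds (A (e β)))) (h : F) :
    Tendsto (fun i => T i h) l (nhds (A h)) := by
  have hspan : ∀ g ∈ Submodule.span ℂ (Set.range e),
      Tendsto (fun i => T i g) l (nhds (A g)) := by
    intro g hg
    induction hg using Submodule.span_induction with
    | mem x hx => obtain ⟨β, rfl⟩ := hx; exact he β
    | zero => simpa using tendsto_const_nhds
    | add x y _ _ hx hy => simpa using hx.add hy
    | smul c x _ hx => simpa using hx.const_smul c
  have hd : Dense (Submodule.span ℂ (Set.range e) : Set F) :=
    (Submodule.dense_iff_topologicalClosure_eq_top).2 e.dense_span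
  rw [Metric.tendsto_nhds]
  intro ε hε
  have hK : 0 < |M| + ‖A‖ + 1 := by positivity
  obtain ⟨g, hg, hgh⟩ := hd.exists_dist_lt h (show 0 < ε / 2 / (|M| + ‖A‖ + 1) by positivity)
  rw [dist_eq_norm, lt_div_iff₀ hK] at hgh
  filter_upwards [hT, (Metric.tendsto_nhds.1 (hspan g hg)) (ε / 2) (by positivity)] with i hi hi'
  rw [dist_eq_norm] at hi' ⊢
  have h1 : T i h - A h = T i (h - g) + (T i g - A g) - A (h - g) := by
    simp only [map_sub]; abel
  have h2 : ‖T i (h - g)‖ ≤ |M| * ‖h - g‖ :=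
    (T i).le_of_opNorm_le (hi.trans (le_abs_self M)) _
  have h3 : ‖A (h - g)‖ ≤ ‖A‖ * ‖h - g‖ := A.le_opNorm _
  have h4 := norm_sub_le (T i (h - g) + (T i g - A g)) (A (h - g))
  have h5 := norm_add_le (T i (h - g)) (T i g - A g)
  rw [h1]
  nlinarith [norm_nonneg (h - g)]

theorem HilbertBasis.tendsto_apply_of_schur (e : HilbertBasis ι ℂ F) (d : ι → ι → ℕ)
    {A : F →L[ℂ] F} {T : ℝ → F →L[ℂ] F}
    (h : ∀ r ∈ Set.Ico (0 : ℝ) 1, ∀ α β,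
      inner ℂ (e α) (T r (e β)) = (r : ℂ) ^ d α β * inner ℂ (e α) (A (e β))) (β : ι) :
    Tendsto (fun r => T r (e β)) (nhdsWithin 1 (Set.Ico (0 : ℝ) 1)) (nhds (A (e β))) := by
  have hev : ∀ᶠ r in nhdsWithin (1 : ℝ) (Set.Ico (0 : ℝ) 1), r ∈ Set.Ico (0 : ℝ) 1 :=
    eventually_mem_nhdsWithin
  have hlim : Tendsto
      (fun r : ℝ => ∑' α, ‖((r : ℂ) ^ d α β - 1) * inner ℂ (e α) (A (e β))‖ ^ 2)
      (nhdsWithin 1 (Set.Ico (0 : ℝ) 1)) (nhds (∑' _ : ι, (0 : ℝ))) := by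
    refine tendsto_tsum_of_dominated_convergence
      (e.hasSum_norm_inner_sq (A (e β))).summable (fun α => ?_) ?_
    · have hc : Continuous
          (fun r : ℝ => ‖((r : ℂ) ^ d α β - 1) * inner ℂ (e α) (A (e β))‖ ^ 2) := by fun_prop
      have := hc.tendsto 1
      simp only [Complex.ofReal_one, one_pow, sub_self, zero_mul, norm_zero, ne_eq,
        OfNat.ofNat_ne_zero, not_false_eq_true, zero_pow] at this
      exact this.mono_left nhdsWithin_le_nhds
    · filter_upwards [hev] with r hr α
      have h1 : ‖(r : ℂ) ^ d α β - 1‖ ≤ 1 := by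
        rw [← Complex.ofReal_pow, ← Complex.ofReal_one, ← Complex.ofReal_sub, Complex.norm_real,
          Real.norm_eq_abs, abs_le]
        have := pow_le_one₀ (n := d α β) hr.1 hr.2.le
        have := pow_nonneg hr.1 (d α β)
        constructor <;> linarith
      rw [Real.norm_of_nonneg (by positivity), norm_mul]
      gcongr
      exact mul_le_of_le_one_left (norm_nonneg _) h1
  rw [tsum_zero] at hlim
  rw [tendsto_iff_norm_sub_tendsto_zero]
  have hsq := (hlim.sqrt).congr' (f₂ := fun r => ‖T r (e β) - A (e β)‖) ?_
  · simpa using hsq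
  · filter_upwards [hev] with r hr
    rw [← Real.sqrt_sq (norm_nonneg (T r (e β) - A (e β))),
      ← (e.hasSum_norm_inner_sq (T r (e β) - A (e β))).tsum_eq]
    simp only [inner_sub_right, h r hr, sub_mul, one_mul]

end Schur

section Words

variable {n : ℕ}

theorem wordLen_mul (α β : Word n) : wordLen (α * β) = wordLen α + wordLen β := by
  simp [wordLen, FreeMonoid.toList_mul]

theorem wordLen_of (i : Fin n) : wordLen (FreeMonoid.of i) = 1 := rfl

theorem wordLen_word {k : ℕ} (f : Fin k → Fin n) : wordLen (word f) = k := by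
  simp [wordLen, word]

theorem wordLen_eq_zero {α : Word n} : wordLen α = 0 ↔ α = 1 := List.length_eq_zero_iff

theorem wordLen_one : wordLen (1 : Word n) = 0 := rfl

theorem word_injective {k : ℕ} : Function.Injective (word : (Fin k → Fin n) → Word n) :=
  fun _ _ h => List.ofFn_injective h

theorem exists_word_eq (α : Word n) : ∃ f : Fin (wordLen α) → Fin n, word f = α :=
  ⟨(FreeMonoid.toList α).get, List.ofFn_get _⟩

theorem mul_of_inj {α β : Word n} {i j : Fin n} :
    α * FreeMonoid.of i = β * FreeMonoid.of j ↔ α = β ∧ i = j := by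
  constructor
  · intro h
    exact List.append_singleton_inj.1
      (show FreeMonoid.toList α ++ [i] = FreeMonoid.toList β ++ [j] from h)
  · rintro ⟨rfl, rfl⟩; rfl

theorem word_mul_inj {k : ℕ} {f g : Fin k → Fin n} {α β : Word n} :
    word f * α = word g * β ↔ f = g ∧ α = β := by
  constructor
  · intro h
    obtain ⟨h1, h2⟩ := List.append_inj
      (show FreeMonoid.toList (word f) ++ FreeMonoid.toList α
        = FreeMonoid.toList (word g) ++ FreeMonoid.toList β from h)
      (by simp [word])
    exact ⟨word_injective h1, h2⟩
  · rintro ⟨rfl, rfl⟩; rfl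

/-- Induction on words by appending letters on the right. -/
theorem Word.reverseInduction {p : Word n → Prop} (one : p 1)
    (mul_of : ∀ α i, p α → p (α * FreeMonoid.of i)) (α : Word n) : p α :=
  List.reverseRecOn (motive := fun l => p (FreeMonoid.ofList l)) α one fun l i h => mul_of l i h

open scoped Classical in
theorem sum_word_ite_eq (c : Word n → ℂ) (k : ℕ) (α : Word n) :
    (∑ f : Fin k → Fin n, c (word f) * if α = word f then 1 else 0)
      = if wordLen α = k then c α else 0 := by
  split_ifs with hk
  · subst hk
    obtain ⟨f, hf⟩ := exists_word_eq α
    rw [Finset.sum_eq_single f]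
    · simp [hf]
    · intro g _ hg
      rw [if_neg, mul_zero]
      intro h
      exact hg (word_injective (h.symm.trans hf.symm))
    · simp
  · refine Finset.sum_eq_zero fun f _ => ?_
    rw [if_neg, mul_zero]
    rintro rfl
    exact hk (wordLen_word f)

open scoped Classical in
theorem tsum_ite_wordLen (c : Word n → ℂ) (α : Word n) :
    (∑' k : ℕ, if wordLen α = k + 1 then c α else 0) = if α = 1 then 0 else c α := by
  split_ifs with h
  · simp [h, wordLen_one]
  · have h0 : wordLen α ≠ 0 := fun h' => h (wordLen_eq_zero.1 h')
    obtain ⟨m, hm⟩ := Nat.exists_eq_succ_of_ne_zero h0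
    rw [tsum_eq_single m]
    · simp [hm]
    · intro k hk
      rw [if_neg (by lia)]

end Words

theorem norm_scaleCoef_word {n : ℕ} (r : ℝ) (c : Word n → ℂ) {k : ℕ} (f : Fin k → Fin n) :
    ‖scaleCoef r c (word f)‖ = |r| ^ k * ‖c (word f)‖ := by
  simp [scaleCoef, wordLen_word]

section Fock

variable {n : ℕ} {F : Type} [NormedAddCommGroup F] [InnerProductSpace ℂ F]
  {e : HilbertBasis (Word n) ℂ F} {S : Fin n → F →L[ℂ] F}

theorem wordProd_apply_basis
    (hS : ∀ (i : Fin n) (α : Word n), S i (e α) = e (FreeMonoid.of i * α)) (α β : Word n) :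
    wordProd S α (e β) = e (α * β) := by
  induction α using FreeMonoid.inductionOn' with
  | one => simp [wordProd]
  | of_mul i α ih =>
    have : wordProd S (FreeMonoid.of i * α) = S i * wordProd S α := by
      simp [wordProd, FreeMonoid.toList_mul]
    rw [this, mul_def, comp_apply, ih, hS, mul_assoc]

theorem sum_norm_inner_word_sq_le (e : HilbertBasis (Word n) ℂ F) (x : F) (k : ℕ) :
    ∑ f : Fin k → Fin n, ‖inner ℂ (e (word f)) x‖ ^ 2 ≤ ‖x‖ ^ 2 := by
  have := sum_le_hasSum (Finset.univ.map ⟨word, word_injective (n := n) (k := k)⟩)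
    (fun _ _ => by positivity) (e.hasSum_norm_inner_sq x)
  simpa using this

open scoped Classical in
theorem inner_basis_eq_ite (e : HilbertBasis (Word n) ℂ F) (α β : Word n) :
    inner ℂ (e α) (e β) = if α = β then (1 : ℂ) else 0 :=
  orthonormal_iff_ite.1 e.orthonormal α β

open scoped Classical in
theorem inner_truncSum
    (hS : ∀ (i : Fin n) (α : Word n), S i (e α) = e (FreeMonoid.of i * α))
    (c : Word n → ℂ) (k : ℕ) (α β : Word n) :
    inner ℂ (e α) (truncSum c S k (e β))
      = ∑ f : Fin k → Fin n, c (word f) * if α = word f * β then 1 else 0 := by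
  simp [truncSum, sum_apply, wordProd_apply_basis hS,
    inner_basis_eq_ite]

theorem inner_tsum_apply {T : ℕ → F →L[ℂ] F} (hT : Summable T) (x y : F) :
    inner ℂ x ((∑' k, T k) y) = ∑' k, inner ℂ x (T k y) :=
  ((innerSL ℂ x ∘L ContinuousLinearMap.apply ℂ F y).map_tsum hT)

variable [CompleteSpace F]

open scoped Classical in
theorem inner_truncSumAdj
    (hS : ∀ (i : Fin n) (α : Word n), S i (e α) = e (FreeMonoid.of i * α))
    (c : Word n → ℂ) (k : ℕ) (α β : Word n) :
    inner ℂ (e α) (truncSumAdj c S k (e β))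
      = ∑ f : Fin k → Fin n, c (word f) * if β = word f * α then 1 else 0 := by
  simp [truncSumAdj, sum_apply, wordProd_apply_basis hS,
    inner_basis_eq_ite, adjoint_inner_right, eq_comm]

open scoped Classical in
theorem adjoint_wordProd_comp_wordProd
    (hS : ∀ (i : Fin n) (α : Word n), S i (e α) = e (FreeMonoid.of i * α))
    {k : ℕ} (f g : Fin k → Fin n) :
    adjoint (wordProd S (word f)) ∘L wordProd S (word g) = if f = g then 1 else 0 := by
  refine e.clm_ext fun α β => ?_
  rw [comp_apply, adjoint_inner_right, wordProd_apply_basis hS, wordProd_apply_basis hS,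
    inner_basis_eq_ite]
  simp only [word_mul_inj]
  by_cases h : f = g <;> simp [h, inner_basis_eq_ite]

theorem norm_truncSum_le
    (hS : ∀ (i : Fin n) (α : Word n), S i (e α) = e (FreeMonoid.of i * α))
    (c : Word n → ℂ) (k : ℕ) :
    ‖truncSum c S k‖ ≤ √(∑ f : Fin k → Fin n, ‖c (word f)‖ ^ 2) := by
  classical
  refine opNorm_le_of_unit_norm (by positivity) fun x hx => Real.le_sqrt_of_sq_le (le_of_eq ?_)
  have ho : Orthonormal ℂ fun f : Fin k → Fin n => wordProd S (word f) x := by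
    rw [orthonormal_iff_ite]
    intro f g
    rw [← adjoint_inner_right, ← comp_apply, adjoint_wordProd_comp_wordProd hS]
    split_ifs <;> simp [inner_self_eq_norm_sq_to_K, hx]
  simpa [truncSum, sum_apply] using ho.norm_sum_smul_sq Finset.univ fun f => c (word f)

theorem truncSumAdj_eq_adjoint (c : Word n → ℂ) (k : ℕ) :
    truncSumAdj c S k = adjoint (truncSum (fun α => star (c α)) S k) := by
  simp [truncSumAdj, truncSum, map_sum, LinearIsometryEquiv.map_smulₛₗ]

theorem norm_truncSumAdj_le
    (hS : ∀ (i : Fin n) (α : Word n), S i (e α) = e (FreeMonoid.of i * α))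
    (c : Word n → ℂ) (k : ℕ) :
    ‖truncSumAdj c S k‖ ≤ √(∑ f : Fin k → Fin n, ‖c (word f)‖ ^ 2) := by
  rw [truncSumAdj_eq_adjoint, LinearIsometryEquiv.norm_map]
  simpa using norm_truncSum_le hS (fun α => star (c α)) k

theorem sqrt_sum_scaleCoef_le {c : Word n → ℂ} {M r : ℝ} (hM : 0 ≤ M) (hr : 0 ≤ r) {k : ℕ}
    (hc : ∑ f : Fin k → Fin n, ‖c (word f)‖ ^ 2 ≤ M ^ 2) :
    √(∑ f : Fin k → Fin n, ‖scaleCoef r c (word f)‖ ^ 2) ≤ r ^ k * M := by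
  refine Real.sqrt_le_iff.2 ⟨by positivity, ?_⟩
  simp only [norm_scaleCoef_word, abs_of_nonneg hr, mul_pow]
  rw [← Finset.mul_sum]
  gcongr

theorem summable_truncSum_scaleCoef
    (hS : ∀ (i : Fin n) (α : Word n), S i (e α) = e (FreeMonoid.of i * α))
    {c : Word n → ℂ} {M r : ℝ} (hM : 0 ≤ M) (hr0 : 0 ≤ r) (hr1 : r < 1)
    (hc : ∀ k : ℕ, ∑ f : Fin (k + 1) → Fin n, ‖c (word f)‖ ^ 2 ≤ M ^ 2) :
    Summable fun k : ℕ => truncSum (scaleCoef r c) S (k + 1) :=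
  (((summable_geometric_of_lt_one hr0 hr1).comp_injective
    (add_left_injective 1)).mul_right M).of_norm_bounded
    fun k => (norm_truncSum_le hS _ _).trans (sqrt_sum_scaleCoef_le hM hr0 (hc k))

theorem summable_truncSumAdj_scaleCoef
    (hS : ∀ (i : Fin n) (α : Word n), S i (e α) = e (FreeMonoid.of i * α))
    {c : Word n → ℂ} {M r : ℝ} (hM : 0 ≤ M) (hr0 : 0 ≤ r) (hr1 : r < 1)
    (hc : ∀ k : ℕ, ∑ f : Fin (k + 1) → Fin n, ‖c (word f)‖ ^ 2 ≤ M ^ 2) :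
    Summable fun k : ℕ => truncSumAdj (scaleCoef r c) S (k + 1) :=
  (((summable_geometric_of_lt_one hr0 hr1).comp_injective
    (add_left_injective 1)).mul_right M).of_norm_bounded
    fun k => (norm_truncSumAdj_le hS _ _).trans (sqrt_sum_scaleCoef_le hM hr0 (hc k))

open scoped Classical in
theorem inner_phOp
    (hS : ∀ (i : Fin n) (α : Word n), S i (e α) = e (FreeMonoid.of i * α))
    {a b : Word n → ℂ} (ha : Summable fun k : ℕ => truncSum a S (k + 1))
    (hb : Summable fun k : ℕ => truncSumAdj b S (k + 1)) (α β : Word n) :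
    inner ℂ (e α) (phOp a b S (e β))
      = (∑' k : ℕ, ∑ f : Fin (k + 1) → Fin n, b (word f) * if β = word f * α then 1 else 0)
        + (if α = β then a 1 else 0)
        + ∑' k : ℕ, ∑ f : Fin (k + 1) → Fin n, a (word f) * if α = word f * β then 1 else 0 := by
  simp only [phOp, add_apply, inner_add_right, inner_tsum_apply ha, inner_tsum_apply hb,
    inner_truncSum hS, inner_truncSumAdj hS]
  simp [inner_smul_right, inner_basis_eq_ite]

theorem inner_phOp_one_right
    (hS : ∀ (i : Fin n) (α : Word n), S i (e α) = e (FreeMonoid.of i * α))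
    {a b : Word n → ℂ} (ha : Summable fun k : ℕ => truncSum a S (k + 1))
    (hb : Summable fun k : ℕ => truncSumAdj b S (k + 1)) (α : Word n) :
    inner ℂ (e α) (phOp a b S (e 1)) = a α := by
  classical
  have h0 : ∀ (k : ℕ) (f : Fin (k + 1) → Fin n), ¬ 1 = word f * α := fun k f h => by
    have := congrArg wordLen h
    rw [wordLen_mul, wordLen_word, wordLen_one] at this
    lia
  rw [inner_phOp hS ha hb]
  simp only [h0, if_false, mul_zero, Finset.sum_const_zero, tsum_zero, zero_add, mul_one,
    sum_word_ite_eq, tsum_ite_wordLen]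
  split_ifs with h <;> simp [h]

theorem inner_phOp_one_left
    (hS : ∀ (i : Fin n) (α : Word n), S i (e α) = e (FreeMonoid.of i * α))
    {a b : Word n → ℂ} (ha : Summable fun k : ℕ => truncSum a S (k + 1))
    (hb : Summable fun k : ℕ => truncSumAdj b S (k + 1)) {β : Word n} (hβ : 1 ≤ wordLen β) :
    inner ℂ (e 1) (phOp a b S (e β)) = b β := by
  classical
  have h0 : ∀ (k : ℕ) (f : Fin (k + 1) → Fin n), ¬ 1 = word f * β := fun k f h => by
    have := congrArg wordLen h
    rw [wordLen_mul, wordLen_word, wordLen_one] at this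
    lia
  have hne : β ≠ 1 := by rintro rfl; simp [wordLen_one] at hβ
  rw [inner_phOp hS ha hb]
  simp only [h0, if_false, mul_zero, Finset.sum_const_zero, tsum_zero, add_zero, mul_one,
    sum_word_ite_eq, tsum_ite_wordLen, hne, hne.symm]

theorem inner_phOp_mul_of
    (hS : ∀ (i : Fin n) (α : Word n), S i (e α) = e (FreeMonoid.of i * α))
    {a b : Word n → ℂ} (ha : Summable fun k : ℕ => truncSum a S (k + 1))
    (hb : Summable fun k : ℕ => truncSumAdj b S (k + 1)) (α β : Word n) (i j : Fin n) :
    inner ℂ (e (α * FreeMonoid.of i)) (phOp a b S (e (β * FreeMonoid.of j)))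
      = if i = j then inner ℂ (e α) (phOp a b S (e β)) else 0 := by
  classical
  simp only [inner_phOp hS ha hb, ← mul_assoc, mul_of_inj]
  by_cases h : i = j
  · simp [h]
  · simp [h, Ne.symm h]

end Fock

/-- A kernel that is invariant under right translations is determined by its values
on the pairs `(α, 1)` and `(1, β)`. -/
theorem toeplitz_kernel_eq {n : ℕ} {r : ℝ} {P M : Word n → Word n → ℂ}
    (hP : ∀ α β i j, P (α * FreeMonoid.of i) (β * FreeMonoid.of j) = if i = j then P α β else 0)
    (hM : ∀ α β i j, M (α * FreeMonoid.of i) (β * FreeMonoid.of j) = if i = j then M α β else 0)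
    (hr : ∀ α, P α 1 = (r : ℂ) ^ wordLen α * M α 1)
    (hl : ∀ β, 1 ≤ wordLen β → P 1 β = (r : ℂ) ^ wordLen β * M 1 β) (α β : Word n) :
    P α β = (r : ℂ) ^ ((wordLen α - wordLen β) + (wordLen β - wordLen α)) * M α β := by
  induction α using Word.reverseInduction generalizing β with
  | one =>
    rcases Nat.eq_zero_or_pos (wordLen β) with h | h
    · rw [wordLen_eq_zero.1 h, hr]; simp [wordLen_one]
    · rw [hl β h]; simp [wordLen_one]
  | mul_of α i ih =>
    induction β using Word.reverseInduction with
    | one => rw [hr]; simp [wordLen_one]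
    | mul_of β j _ =>
      rw [hP, hM]
      simp only [wordLen_mul, wordLen_of, Nat.add_sub_add_right]
      split_ifs
      · exact ih β
      · simp

/-- A multi-Toeplitz operator is recaptured from its Fourier series:
square-summability of the coefficients, strong convergence of the radial operators to `A`,
and the norm of `A` as the (monotone) supremum/limit of the norms of the radial operators. -/
theorem stmt_2 (n : ℕ) (hn : 1 ≤ n)
    (F : Type) [NormedAddCommGroup F] [InnerProductSpace ℂ F] [CompleteSpace F]
    (e : HilbertBasis (Word n) ℂ F)
    (S R : Fin n → F →L[ℂ] F)
    (hS : ∀ (i : Fin n) (α : Word n), S i (e α) = e (FreeMonoid.of i * α))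
    (hR : ∀ (i : Fin n) (α : Word n), R i (e α) = e (α * FreeMonoid.of i))
    (A : F →L[ℂ] F)
    (hA : ∀ i j : Fin n, adjoint (R i) ∘L A ∘L R j = if i = j then A else 0)
    (a b : Word n → ℂ)
    (hFa : ∀ α : Word n, (inner ℂ (e α) (A (e 1)) : ℂ) = a α)
    (hFb : ∀ α : Word n, 1 ≤ wordLen α → (inner ℂ (e 1) (A (e α)) : ℂ) = b α) :
    -- (a) square-summability and norm convergence of the series defining the radial function
    ((Summable fun α : Word n => ‖a α‖ ^ 2) ∧
      (Summable fun β : {α : Word n // 1 ≤ wordLen α} => ‖b (β : Word n)‖ ^ 2) ∧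
      (∀ r : ℝ, 0 ≤ r → r < 1 →
        Summable (fun k : ℕ => truncSumAdj (scaleCoef r b) S (k + 1)) ∧
        Summable (fun k : ℕ => truncSum (scaleCoef r a) S (k + 1)))) ∧
    -- (b) `A h = lim_{r → 1⁻} φ_r h` for every `h`
    (∀ h : F,
      Tendsto (fun r : ℝ => phOp (scaleCoef r a) (scaleCoef r b) S h)
        (nhdsWithin 1 (Set.Ico (0 : ℝ) 1)) (nhds (A h))) ∧
    -- (c) `r ↦ ‖φ_r‖` is nondecreasing and `‖A‖ = sup_r ‖φ_r‖ = lim_{r → 1⁻} ‖φ_r‖`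
    (MonotoneOn (fun r : ℝ => ‖phOp (scaleCoef r a) (scaleCoef r b) S‖)
        (Set.Ico (0 : ℝ) 1) ∧
      IsLUB ((fun r : ℝ => ‖phOp (scaleCoef r a) (scaleCoef r b) S‖) '' Set.Ico (0 : ℝ) 1)
        ‖A‖ ∧
      Tendsto (fun r : ℝ => ‖phOp (scaleCoef r a) (scaleCoef r b) S‖)
        (nhdsWithin 1 (Set.Ico (0 : ℝ) 1)) (nhds ‖A‖)) := by
  have hb' : ∀ α : Word n, 1 ≤ wordLen α →
      ‖b α‖ = ‖(inner ℂ (e α) (adjoint A (e 1)) : ℂ)‖ := fun α hα => by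
    rw [adjoint_inner_right, norm_inner_symm, hFb α hα]
  have hbound_a : ∀ k : ℕ, ∑ f : Fin (k + 1) → Fin n, ‖a (word f)‖ ^ 2 ≤ ‖A (e 1)‖ ^ 2 := by
    intro k
    simpa only [hFa] using sum_norm_inner_word_sq_le e (A (e 1)) (k + 1)
  have hbound_b : ∀ k : ℕ,
      ∑ f : Fin (k + 1) → Fin n, ‖b (word f)‖ ^ 2 ≤ ‖adjoint A (e 1)‖ ^ 2 := by
    intro k
    refine le_of_eq_of_le (Finset.sum_congr rfl fun f _ => ?_)
      (sum_norm_inner_word_sq_le e (adjoint A (e 1)) (k + 1))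
    rw [hb' _ (by rw [wordLen_word]; lia)]
  have hsum_a : ∀ r : ℝ, 0 ≤ r → r < 1 →
      Summable (fun k : ℕ => truncSum (scaleCoef r a) S (k + 1)) := fun r hr0 hr1 =>
    summable_truncSum_scaleCoef hS (norm_nonneg _) hr0 hr1 hbound_a
  have hsum_b : ∀ r : ℝ, 0 ≤ r → r < 1 →
      Summable (fun k : ℕ => truncSumAdj (scaleCoef r b) S (k + 1)) := fun r hr0 hr1 =>
    summable_truncSumAdj_scaleCoef hS (norm_nonneg _) hr0 hr1 hbound_b
  have hAmul : ∀ (α β : Word n) (i j : Fin n),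
      (inner ℂ (e (α * FreeMonoid.of i)) (A (e (β * FreeMonoid.of j))) : ℂ)
        = if i = j then inner ℂ (e α) (A (e β)) else 0 := by
    intro α β i j
    rw [← hR, ← hR, ← adjoint_inner_right, ← comp_apply A, ← comp_apply (adjoint (R i)), hA]
    split_ifs <;> simp
  set φ : ℝ → F →L[ℂ] F := fun r => phOp (scaleCoef r a) (scaleCoef r b) S
  have hmat : ∀ r ∈ Set.Ico (0 : ℝ) 1, ∀ α β : Word n,
      (inner ℂ (e α) (φ r (e β)) : ℂ)
        = (r : ℂ) ^ ((wordLen α - wordLen β) + (wordLen β - wordLen α))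
          * inner ℂ (e α) (A (e β)) := by
    intro r hr
    have ha := hsum_a r hr.1 hr.2
    have hb := hsum_b r hr.1 hr.2
    refine toeplitz_kernel_eq (P := fun α β => inner ℂ (e α) (φ r (e β)))
      (inner_phOp_mul_of hS ha hb) hAmul (fun α => ?_) (fun β hβ => ?_)
    · rw [hFa]
      exact inner_phOp_one_right hS ha hb α
    · rw [hFb β hβ]
      exact inner_phOp_one_left hS ha hb hβ
  have hle : ∀ r ∈ Set.Ico (0 : ℝ) 1, ‖φ r‖ ≤ ‖A‖ := fun r hr =>
    e.opNorm_le_of_schur wordLen hr.1 hr.2.le A (φ r) (hmat r hr)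
  have hmono : MonotoneOn (fun r : ℝ => ‖φ r‖) (Set.Ico (0 : ℝ) 1) := by
    intro r hr s hs hrs
    rcases hs.1.eq_or_lt with h0 | h0
    · rw [le_antisymm (h0 ▸ hrs) hr.1, ← h0]
    · refine e.opNorm_le_of_schur wordLen (r := r / s) (div_nonneg hr.1 hs.1)
        (div_le_one_of_le₀ hrs hs.1) (φ s) (φ r) fun α β => ?_
      have hs0 : (s : ℂ) ≠ 0 := by exact_mod_cast h0.ne'
      rw [hmat r hr, hmat s hs, ← mul_assoc, ← mul_pow, Complex.ofReal_div, div_mul_cancel₀ _ hs0]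
  have hev : ∀ᶠ r in nhdsWithin (1 : ℝ) (Set.Ico (0 : ℝ) 1), r ∈ Set.Ico (0 : ℝ) 1 :=
    eventually_mem_nhdsWithin
  have hstrong : ∀ h : F, Tendsto (fun r : ℝ => φ r h)
      (nhdsWithin 1 (Set.Ico (0 : ℝ) 1)) (nhds (A h)) :=
    e.tendsto_apply_of_eventually_norm_le (hev.mono hle) (e.tendsto_apply_of_schur _ hmat)
  have hneBot : (nhdsWithin (1 : ℝ) (Set.Ico (0 : ℝ) 1)).NeBot := by
    rw [← mem_closure_iff_nhdsWithin_neBot, closure_Ico zero_ne_one]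
    exact ⟨zero_le_one, le_rfl⟩
  have hlub : IsLUB ((fun r : ℝ => ‖φ r‖) '' Set.Ico (0 : ℝ) 1) ‖A‖ := by
    refine ⟨?_, fun M hM => ?_⟩
    · rintro _ ⟨r, hr, rfl⟩
      exact hle r hr
    · have hM' : ∀ r ∈ Set.Ico (0 : ℝ) 1, ‖φ r‖ ≤ M := fun r hr => hM ⟨r, hr, rfl⟩
      refine A.opNorm_le_bound ((norm_nonneg _).trans (hM' 0 ⟨le_rfl, zero_lt_one⟩)) fun h => ?_
      exact le_of_tendsto (hstrong h).norm
        (hev.mono fun r hr => (φ r).le_of_opNorm_le (hM' r hr) h)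
  refine ⟨⟨?_, ?_, fun r hr0 hr1 => ⟨hsum_b r hr0 hr1, hsum_a r hr0 hr1⟩⟩, hstrong, hmono, hlub, ?_⟩
  · simpa only [hFa] using (e.hasSum_norm_inner_sq (A (e 1))).summable
  · refine ((e.hasSum_norm_inner_sq (adjoint A (e 1))).summable.comp_injective
      Subtype.val_injective).congr fun β => ?_
    simp only [Function.comp_apply, hb' β.1 β.2]
  · refine tendsto_order.2 ⟨fun c hc => ?_, fun c hc => hev.mono fun r hr => (hle r hr).trans_lt hc⟩
    obtain ⟨_, ⟨s, hs, rfl⟩, hcs, -⟩ := hlub.exists_between hc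
    filter_upwards [hev, mem_nhdsWithin_of_mem_nhds (lt_mem_nhds hs.2)] with r hr hsr
    exact hcs.trans_le (hmono hs hr hsr.le)

end
end
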